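/- There exists a symmetric generating set Σ for the group ℤ_ω = ⨁_{ℵ_0} ℤ (the direct sum of countably many copies of ℤ) such that the Cayley graph Cay(ℤ_ω,Σ), endowed with the word metric, contains isometric copies of M_n^* for arbitrarily large even n; that is, for each even n, M_n^* embeds isometrically into (ℤ_ω, d_Σ). -/

import Mathlib

/-- The word metric on an (additive) group `G` with respect to a generating set `S`:
`wordDist S a b` is the least `k` such that `b − a` is a sum of `k` elements of `S`. -/
noncomputable def wordDist {G : Type*} [AddCommGroup G] (S : Set G) (a b : G) : ℕ :=
  sInf {k : ℕ | ∃ w : Fin k → G, (∀ i, w i ∈ S) ∧ ∑ i, w i = b - a}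

/-- `S` is a symmetric generating set of the (additive) group `G`:
`−S = S`, `0 ∉ S`, and every element of `G` is a sum of elements of `S`. -/
def IsSymmGenSet {G : Type*} [AddCommGroup G] (S : Set G) : Prop :=
  (∀ s ∈ S, -s ∈ S) ∧ (0 : G) ∉ S ∧
    ∀ x : G, ∃ (k : ℕ) (w : Fin k → G), (∀ i, w i ∈ S) ∧ ∑ i, w i = x

/-- The metric of `M_n^*` (the set of integer points of `M_n`, i.e. `{1,…,n^n}^{n^n}`
with the supremum of the coordinatewise cyclic metrics), as a `ℕ`-valued distance. -/
def MnStarDist (n : ℕ) (x y : Fin (n ^ n) → ℤ) : ℕ :=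
  Finset.univ.sup fun i => min (x i - y i).natAbs (n ^ n - (x i - y i).natAbs)

/-- The nonzero vectors of supremum norm `1` in `⨁ ℤ`. -/
def supUnitSphere : Set (ℕ →₀ ℤ) :=
  {s | s ≠ 0 ∧ ∀ i, (s i).natAbs ≤ 1}

/-- `k` is the supremum norm of `v`. -/
def IsSupNorm (v : ℕ →₀ ℤ) (k : ℕ) : Prop :=
  (∀ i, (v i).natAbs ≤ k) ∧ (k = 0 ∨ ∃ i, (v i).natAbs = k)

theorem exists_isSupNorm (v : ℕ →₀ ℤ) : ∃ k, IsSupNorm v k := by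
  refine ⟨v.support.sup fun i => (v i).natAbs, fun i => ?_, ?_⟩
  · by_cases hi : i ∈ v.support
    · exact Finset.le_sup (f := fun i => (v i).natAbs) hi
    · simp [Finsupp.notMem_support_iff.mp hi]
  · rcases v.support.eq_empty_or_nonempty with h | h
    · left
      simp [h]
    · obtain ⟨i, -, hi⟩ := Finset.exists_mem_eq_sup _ h fun i => (v i).natAbs
      exact Or.inr ⟨i, hi.symm⟩

theorem IsSupNorm.exists_sum {k : ℕ} {v : ℕ →₀ ℤ} (h : IsSupNorm v k) :
    ∃ w : Fin k → ℕ →₀ ℤ, (∀ i, w i ∈ supUnitSphere) ∧ ∑ i, w i = v := by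
  induction k generalizing v with
  | zero =>
    refine ⟨fun _ => 0, fun i => i.elim0, ?_⟩
    ext i
    have := h.1 i
    simp
    omega
  | succ k ih =>
    obtain ⟨j, hj⟩ := h.2.resolve_left k.succ_ne_zero
    set s : ℕ →₀ ℤ := v.mapRange Int.sign Int.sign_zero with hs
    have sub_apply (i : ℕ) : ((v - s) i).natAbs = (v i).natAbs - 1 := by
      rw [Finsupp.sub_apply, hs, Finsupp.mapRange_apply]
      rcases lt_trichotomy (v i) 0 with hi | hi | hi
      · rw [Int.sign_eq_neg_one_of_neg hi]; omega
      · simp [hi]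
      · rw [Int.sign_eq_one_of_pos hi]; omega
    have hs_mem : s ∈ supUnitSphere := by
      refine ⟨fun h0 => ?_, fun i => ?_⟩
      · have := sub_apply j
        rw [h0, sub_zero] at this
        omega
      · rw [hs, Finsupp.mapRange_apply, Int.natAbs_sign]
        split_ifs <;> omega
    obtain ⟨w, hw, hsum⟩ := ih (v := v - s)
      ⟨fun i => by have := h.1 i; rw [sub_apply]; omega,
        Or.inr ⟨j, by rw [sub_apply]; omega⟩⟩
    refine ⟨Fin.cons s w, fun i => ?_, ?_⟩
    · cases i using Fin.cases with
      | zero => simpa using hs_mem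
      | succ i => simpa using hw i
    · rw [Fin.sum_univ_succ]
      simp [hsum]

theorem natAbs_sum_apply_le {k : ℕ} {w : Fin k → ℕ →₀ ℤ} (hw : ∀ i, w i ∈ supUnitSphere)
    (j : ℕ) : ((∑ i, w i) j).natAbs ≤ k := by
  rw [Finsupp.finsetSum_apply]
  calc (∑ i, w i j).natAbs ≤ ∑ i, (w i j).natAbs := Int.natAbs_sum_le _ _
    _ ≤ ∑ _i : Fin k, 1 := Finset.sum_le_sum fun i _ => (hw i).2 j
    _ = k := by simp

theorem wordDist_supUnitSphere {a b : ℕ →₀ ℤ} {k : ℕ} (h : IsSupNorm (b - a) k) :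
    wordDist supUnitSphere a b = k := by
  refine le_antisymm (Nat.sInf_le h.exists_sum) (le_csInf ⟨k, h.exists_sum⟩ ?_)
  rintro m ⟨w, hw, hsum⟩
  rcases h.2 with rfl | ⟨j, hj⟩
  · exact m.zero_le
  · rw [← hj, ← hsum]
    exact natAbs_sum_apply_le hw j

theorem isSymmGenSet_supUnitSphere : IsSymmGenSet supUnitSphere := by
  refine ⟨fun s hs => ⟨neg_ne_zero.mpr hs.1, fun i => ?_⟩, fun h => h.1 rfl, fun x => ?_⟩
  · simpa using hs.2 i
  · obtain ⟨k, hk⟩ := exists_isSupNorm x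
    exact ⟨k, hk.exists_sum⟩

/-- The cyclic distance on `{1, …, N}`. -/
def cyclicDist (N : ℕ) (a b : ℤ) : ℕ :=
  min (a - b).natAbs (N - (a - b).natAbs)

theorem cyclicDist_self (N : ℕ) (a : ℤ) : cyclicDist N a a = 0 := by
  simp [cyclicDist]

theorem natAbs_cyclicDist_sub_le {N : ℕ} {a b c : ℤ} (ha : 1 ≤ a ∧ a ≤ N) (hb : 1 ≤ b ∧ b ≤ N)
    (hc : 1 ≤ c ∧ c ≤ N) :
    ((cyclicDist N b c : ℤ) - cyclicDist N a c).natAbs ≤ cyclicDist N a b := by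
  unfold cyclicDist
  omega

/-- The Fréchet embedding of the power `{1, …, N}^N` of the cyclic metric space: the coordinates
are the distances of the components to all the points of `{1, …, N}`. -/
noncomputable def frechetEmbedding (N : ℕ) (x : Fin N → ℤ) : ℕ →₀ ℤ :=
  Finsupp.embDomain (Encodable.encode' (Fin N × Fin N))
    (Finsupp.equivFunOnFinite.symm fun p => (cyclicDist N (x p.1) (p.2 + 1) : ℤ))

theorem frechetEmbedding_encode (N : ℕ) (x : Fin N → ℤ) (p : Fin N × Fin N) :
    frechetEmbedding N x (Encodable.encode' _ p) = cyclicDist N (x p.1) (p.2 + 1) := by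
  simp [frechetEmbedding, Finsupp.embDomain_apply_self]

theorem isSupNorm_frechetEmbedding_sub {N : ℕ} (hN : 0 < N) {x y : Fin N → ℤ}
    (hx : ∀ i, 1 ≤ x i ∧ x i ≤ N) (hy : ∀ i, 1 ≤ y i ∧ y i ≤ N) :
    IsSupNorm (frechetEmbedding N y - frechetEmbedding N x)
      (Finset.univ.sup fun i => cyclicDist N (x i) (y i)) := by
  refine ⟨fun k => ?_, Or.inr ?_⟩
  · by_cases hk : k ∈ Set.range (Encodable.encode' (Fin N × Fin N))
    · obtain ⟨⟨i, c⟩, rfl⟩ := hk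
      rw [Finsupp.sub_apply, frechetEmbedding_encode, frechetEmbedding_encode]
      exact (natAbs_cyclicDist_sub_le (hx i) (hy i) (by dsimp only; omega)).trans
        (Finset.le_sup (f := fun i => cyclicDist N (x i) (y i)) (Finset.mem_univ i))
    · simp [frechetEmbedding, Finsupp.embDomain_of_notMem_range _ _ _ hk]
  · have : Nonempty (Fin N) := ⟨⟨0, hN⟩⟩
    obtain ⟨i, -, hi⟩ := Finset.exists_mem_eq_sup Finset.univ Finset.univ_nonempty
      fun i => cyclicDist N (x i) (y i)
    have hyi := hy i
    have hc : (((y i - 1).toNat : ℕ) : ℤ) + 1 = y i := by omega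
    refine ⟨Encodable.encode' (Fin N × Fin N) (i, ⟨(y i - 1).toNat, by omega⟩), ?_⟩
    rw [hi, Finsupp.sub_apply, frechetEmbedding_encode, frechetEmbedding_encode]
    simp only [hc, cyclicDist_self]
    simp

/-- Theorem 4 of the paper: there is a symmetric generating set `Σ`
of `ℤ_ω = ⨁_{ℵ₀} ℤ` such that the Cayley graph `Cay(ℤ_ω, Σ)`, with the word metric,
contains isometric copies of `M_n^*` for every (positive) even `n`. -/
theorem cayley_graph_contains_MnStar :
    ∃ S : Set (ℕ →₀ ℤ), IsSymmGenSet S ∧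
      ∀ n : ℕ, 0 < n → Even n →
        ∃ φ : (Fin (n ^ n) → ℤ) → (ℕ →₀ ℤ),
          ∀ x y : Fin (n ^ n) → ℤ,
            (∀ i, 1 ≤ x i ∧ x i ≤ (n : ℤ) ^ n) → (∀ i, 1 ≤ y i ∧ y i ≤ (n : ℤ) ^ n) →
              wordDist S (φ x) (φ y) = MnStarDist n x y := by
  refine ⟨supUnitSphere, isSymmGenSet_supUnitSphere, fun n hn _ =>
    ⟨frechetEmbedding (n ^ n), fun x y hx hy => ?_⟩⟩
  exact wordDist_supUnitSphere (isSupNorm_frechetEmbedding_sub (Nat.pow_pos hn)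
    (by exact_mod_cast hx) (by exact_mod_cast hy))
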